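/- Let (n, θ) be a closed cycle with the θ i not all equal, fix m and odd k ≥ 1 as in the run condition, and let f′ be the closed cycle with n − k − 1 edges whose lengths are obtained from θ by replacing the k + 2 consecutive lengths θ (m−1), θ m, …, θ (m+k) by the single length θ (m−1) − θ m + θ (m+k). Then the folded diameter of f′ equals the folded diameter of (n, θ). -/

import Mathlib

/-- Mountain or valley fold type. -/
inductive MV
  | mountain
  | valley
deriving DecidableEq

/-- Designation of a face as interior or exterior. -/
inductive Des
  | interior
  | exterior
deriving DecidableEq

/-- The sign `ε` used at the top layer: `-1` for an interior face, `+1` for an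
exterior face. -/
def epsOf : Des → ℝ
  | Des.interior => -1
  | Des.exterior => 1

/-- The folded coordinates of a closed cycle: `x 0 = 0` and
`x (i+1) = x i + (-1)^i * θ i`. -/
noncomputable def foldedX (n : ℕ) (θ : ZMod n → ℝ) : ZMod n → ℝ :=
  fun i => ∑ j ∈ Finset.range i.val, (-1 : ℝ) ^ j * θ (j : ZMod n)

/-- `(n, θ)` is a closed cycle: `n` is even, `n ≥ 2`, all edge lengths are
positive, and the alternating sum of the edge lengths is zero. -/
noncomputable def IsClosedCycle (n : ℕ) (θ : ZMod n → ℝ) : Prop :=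
  Even n ∧ 2 ≤ n ∧ (∀ i, 0 < θ i) ∧
    ∑ j ∈ Finset.range n, (-1 : ℝ) ^ j * θ (j : ZMod n) = 0

/-- The open interval whose endpoint set is `{a, b}`. -/
def betw (a b : ℝ) : Set ℝ := Set.Ioo (min a b) (max a b)

/-- `L` is a valid layering of the edges of a cycle folded to coordinates `x`:
`L` is injective; (i) no edge passes strictly between the two edges joined at a
crease at the crease's coordinate; (ii) creases at the same coordinate opening in
the same direction are disjoint or nested. -/
def ValidLayering (n : ℕ) (x L : ZMod n → ℝ) : Prop :=
  Function.Injective L ∧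
  (∀ i e : ZMod n, x i ∈ betw (x e) (x (e + 1)) →
      L e ∉ betw (L (i - 1)) (L i)) ∧
  (∀ i j : ZMod n, i ≠ j → x i = x j →
      Real.sign (x (i + 1) - x i) = Real.sign (x (j + 1) - x j) →
      Disjoint (betw (L (i - 1)) (L i)) (betw (L (j - 1)) (L j)) ∨
        betw (L (i - 1)) (L i) ⊆ betw (L (j - 1)) (L j) ∨
        betw (L (j - 1)) (L j) ⊆ betw (L (i - 1)) (L i))

/-- The layering `L` realizes the MV assignment `μ` with top-layer sign `ε`:
taking `t` to be the index maximizing `L` and `s` the alternating `±1` map with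
`s t = ε`, each crease `i` is a valley iff `s (i-1)` equals the sign of
`L i - L (i-1)`. -/
def Realizes (n : ℕ) (L : ZMod n → ℝ) (μ : ZMod n → MV) (ε : ℝ) : Prop :=
  ∃ t : ZMod n, (∀ j, L j ≤ L t) ∧
    ∃ s : ZMod n → ℝ, (∀ i, s i = 1 ∨ s i = -1) ∧ (∀ i, s (i + 1) = -s i) ∧
      s t = ε ∧
      ∀ i, μ i = MV.valley ↔ s (i - 1) = Real.sign (L i - L (i - 1))

/-- The MV assignment `μ` on the closed cycle `(n, θ)` is flat foldable as a
face with designation `d`: some valid layering of the folded cycle realizes it. -/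
noncomputable def FlatFoldable (n : ℕ) (θ : ZMod n → ℝ) (μ : ZMod n → MV)
    (d : Des) : Prop :=
  ∃ L : ZMod n → ℝ, ValidLayering n (foldedX n θ) L ∧ Realizes n L μ (epsOf d)

/-- The folded diameter of a closed cycle: `max x - min x` over the folded
coordinates. -/
noncomputable def foldedDiameter (n : ℕ) [NeZero n] (θ : ZMod n → ℝ) : ℝ :=
  Finset.univ.sup' ⟨0, Finset.mem_univ 0⟩ (foldedX n θ) -
    Finset.univ.inf' ⟨0, Finset.mem_univ 0⟩ (foldedX n θ)

/-- The edge lengths of the reduced cycle `f'` in the odd case: the `k + 2`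
consecutive lengths `θ (m-1), θ m, …, θ (m+k)` are replaced by the single length
`θ (m-1) - θ m + θ (m+k)` (indexed as the last edge), and edge `j` of `f'`
corresponds to original edge `m + k + 1 + j` otherwise. -/
noncomputable def oddShrink (n : ℕ) (θ : ZMod n → ℝ) (m : ZMod n) (k : ℕ) :
    ZMod (n - k - 1) → ℝ :=
  fun j =>
    if j.val = n - k - 2 then θ (m - 1) - θ m + θ (m + (k : ZMod n))
    else θ (m + (k : ZMod n) + 1 + (j.val : ZMod n))

theorem ord_diam_le {ι κ : Type*} [Fintype ι] [Fintype κ] (hi : (Finset.univ : Finset ι).Nonempty)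
    (hk : (Finset.univ : Finset κ).Nonempty) (f : ι → ℝ) (g : κ → ℝ)
    (h : ∀ i i', ∃ j j', f i - f i' ≤ g j - g j') :
    Finset.univ.sup' hi f - Finset.univ.inf' hi f ≤
      Finset.univ.sup' hk g - Finset.univ.inf' hk g := by
  obtain ⟨i, -, h1⟩ := Finset.exists_mem_eq_sup' hi f
  obtain ⟨i', -, h2⟩ := Finset.exists_mem_eq_inf' hi f
  obtain ⟨j, j', hj⟩ := h i i'
  have h3 := Finset.le_sup' g (Finset.mem_univ j)
  have h4 := Finset.inf'_le g (Finset.mem_univ j')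
  rw [h1, h2]
  linarith

theorem ord_main (n : ℕ) [NeZero n] (θ : ZMod n → ℝ)
    (hcc : IsClosedCycle n θ)
    (m : ZMod n) (k : ℕ) [hN : NeZero (n - k - 1)] (hkodd : Odd k)
    (hrun₁ : θ m < θ (m - 1))
    (hrun₂ : ∀ j : ℕ, j < k → θ (m + (j : ZMod n)) = θ m)
    (hrun₃ : θ m < θ (m + (k : ZMod n))) :
    foldedDiameter (n - k - 1) (oddShrink n θ m k) = foldedDiameter n θ := by
  obtain ⟨hev, hn2, hpos, hsum⟩ := hcc
  have hN0 : n - k - 1 ≠ 0 := hN.out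
  have hkn : k + 3 ≤ n := by
    obtain ⟨r, hr⟩ := hev
    obtain ⟨q, hq⟩ := hkodd
    omega
  obtain ⟨X, hX⟩ : ∃ X : ℕ → ℝ, X = fun i => ∑ j ∈ Finset.range i, (-1 : ℝ) ^ j * θ (j : ZMod n) :=
    ⟨_, rfl⟩
  have hXs : ∀ i, X (i + 1) = X i + (-1 : ℝ) ^ i * θ (i : ZMod n) := by
    intro i; simp [hX, Finset.sum_range_succ]
  have hXn : ∀ i, X (i + n) = X i := by
    intro i
    induction i with
    | zero => simpa [hX] using hsum
    | succ i ih =>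
      rw [show i + 1 + n = (i + n) + 1 by ring, hXs, hXs, ih, pow_add, hev.neg_one_pow]
      simp
  have hfX : ∀ i : ZMod n, foldedX n θ i = X i.val := by
    intro i; simp [hX, foldedX]
  have hXc : ∀ s : ℕ, foldedX n θ (s : ZMod n) = X s := by
    intro s
    rw [hfX, ZMod.val_natCast]
    have : ∀ q r : ℕ, X (r + n * q) = X r := by
      intro q r
      induction q with
      | zero => simp
      | succ q ih => rw [Nat.mul_succ, ← add_assoc, hXn, ih]
    conv_rhs => rw [← Nat.mod_add_div s n, this]
  obtain ⟨a, rfl⟩ : ∃ a : ℕ, m = (a : ZMod n) := ⟨m.val, by simp⟩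
  obtain ⟨p, hp⟩ : ∃ p, p = a + k + 1 := ⟨_, rfl⟩
  obtain ⟨N, hNd⟩ : ∃ N, N = n - k - 1 := ⟨_, rfl⟩
  -- shrunk coordinates
  have hg : ∀ t : ℕ, t < N → foldedX (n - k - 1) (oddShrink n θ a k) (t : ZMod (n - k - 1))
      = (-1 : ℝ) ^ p * (X (p + t) - X p) := by
    intro t ht
    unfold foldedX
    rw [ZMod.val_natCast, Nat.mod_eq_of_lt (by omega)]
    have hsq : ((-1 : ℝ) ^ p) * (-1) ^ p = 1 := by
      rw [← pow_add]; exact Even.neg_one_pow ⟨p, rfl⟩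
    induction t with
    | zero => simp
    | succ t ih =>
      rw [Finset.sum_range_succ, ih (by omega), ← add_assoc, hXs]
      have : oddShrink n θ a k (t : ZMod (n - k - 1)) = θ ((p + t : ℕ) : ZMod n) := by
        unfold oddShrink
        rw [ZMod.val_natCast, Nat.mod_eq_of_lt (by omega), if_neg (by omega), hp]
        push_cast; rfl
      rw [this, pow_add]
      linear_combination (-(-1 : ℝ) ^ t * θ ((p + t : ℕ) : ZMod n)) * hsq
  have hgj : ∀ j : ZMod (n - k - 1), ∃ t, t < N ∧ j = (t : ZMod (n - k - 1)) := by
    intro j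
    exact ⟨j.val, by rw [hNd]; exact ZMod.val_lt j, by simp⟩
  have hsg : (-1 : ℝ) ^ p = 1 ∨ (-1 : ℝ) ^ p = -1 := neg_one_pow_eq_or ℝ p
  -- every coordinate is sandwiched
  have hb : ∀ i : ZMod n, ∃ t t', t < N ∧ t' < N ∧ X (p + t') ≤ foldedX n θ i ∧
      foldedX n θ i ≤ X (p + t) := by
    intro i
    obtain ⟨t, ht, hit⟩ : ∃ t, t < n ∧ foldedX n θ i = X (p + t) := by
      refine ⟨(i - (p : ZMod n)).val, ZMod.val_lt _, ?_⟩
      rw [← hXc]; simp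
    rw [hit]
    by_cases htN : t < N
    · exact ⟨t, t, htN, htN, le_rfl, le_rfl⟩
    obtain ⟨s, rfl⟩ : ∃ s, t = N + s := ⟨t - N, by omega⟩
    obtain ⟨c, hc⟩ : ∃ c, a + n = c + 1 := ⟨a + n - 1, by omega⟩
    have hc1 : (c : ZMod n) = a - 1 := by
      have : ((a + n : ℕ) : ZMod n) = ((c + 1 : ℕ) : ZMod n) := by rw [hc]
      push_cast at this
      rw [ZMod.natCast_self] at this
      rw [eq_sub_iff_add_eq, ← this]; simp
    have e0 : X (c + 1) = X c + (-1 : ℝ) ^ c * θ (a - 1) := by rw [hXs, hc1]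
    have hcj : ∀ j : ℕ, ((c + 1 + j : ℕ) : ZMod n) = (a : ZMod n) + j := by
      intro j; push_cast; rw [hc1]; ring
    have e1 : ∀ s ≤ k, (Even s → X (c + 1 + s) = X (c + 1)) ∧
        (Odd s → X (c + 1 + s) = X (c + 1) - (-1 : ℝ) ^ c * θ a) := by
      intro s hs
      induction s with
      | zero => simp
      | succ s ih =>
        obtain ⟨i1, i2⟩ := ih (by omega)
        have e : X (c + 1 + (s + 1)) = X (c + 1 + s) + (-1 : ℝ) ^ (c + 1 + s) * θ a := by
          rw [← add_assoc, hXs, hcj, hrun₂ s (by omega)]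
        rw [e]
        constructor
        · intro h
          have h' : Odd s := by rcases Nat.even_or_odd s with h1 | h1; · exact absurd h (by simpa [Nat.even_add_one] using h1)
                                exact h1
          rw [i2 h', pow_add _ (c+1), h'.neg_one_pow, pow_succ]; ring
        · intro h
          have h' : Even s := by rcases Nat.even_or_odd s with h1 | h1; · exact h1
                                 exact absurd h (by simpa [Nat.odd_add_one] using h1)
          rw [i1 h', pow_add _ (c+1), h'.neg_one_pow, pow_succ]; ring
    have e2 : X p = X (c + 1) - (-1 : ℝ) ^ c * θ a + (-1 : ℝ) ^ c * θ (a + (k : ZMod n)) := by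
      rw [← hXn p, show p + n = (c + 1 + k) + 1 by omega, hXs, hcj, (e1 k le_rfl).2 hkodd,
        pow_add _ (c+1), hkodd.neg_one_pow, pow_succ]; ring
    have e3 : X (p + (N - 1)) = X c := by congr 1; omega
    have e4 : X (p + (N + s)) = X (c + 1 + s) := by congr 1; omega
    have hpa := hpos a
    have e5 := e1 s (by omega)
    have e6 : X (c + 1 + s) = X (c + 1) ∨ X (c + 1 + s) = X (c + 1) - (-1 : ℝ) ^ c * θ a := by
      rcases Nat.even_or_odd s with h | h
      · exact Or.inl (e5.1 h)
      · exact Or.inr (e5.2 h)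
    rw [e4]
    rcases neg_one_pow_eq_or ℝ c with h | h <;> rw [h] at e0 e2 e6
    · refine ⟨0, N - 1, by omega, by omega, ?_, ?_⟩
      · rw [e3]; rcases e6 with e6 | e6 <;> linarith
      · rw [add_zero]; rcases e6 with e6 | e6 <;> linarith
    · refine ⟨N - 1, 0, by omega, by omega, ?_, ?_⟩
      · rw [add_zero]; rcases e6 with e6 | e6 <;> linarith
      · rw [e3]; rcases e6 with e6 | e6 <;> linarith
  unfold foldedDiameter
  apply le_antisymm
  · apply ord_diam_le
    intro j j'
    obtain ⟨t, ht, rfl⟩ := hgj j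
    obtain ⟨t', ht', rfl⟩ := hgj j'
    rw [hg t ht, hg t' ht']
    rcases hsg with h | h <;> rw [h]
    · refine ⟨((p + t : ℕ) : ZMod n), ((p + t' : ℕ) : ZMod n), ?_⟩
      rw [hXc, hXc]; linarith
    · refine ⟨((p + t' : ℕ) : ZMod n), ((p + t : ℕ) : ZMod n), ?_⟩
      rw [hXc, hXc]; linarith
  · apply ord_diam_le
    intro i i'
    obtain ⟨t, -, ht, -, -, h1⟩ := hb i
    obtain ⟨-, t', -, ht', h2, -⟩ := hb i'
    rcases hsg with h | h
    · refine ⟨(t : ZMod _), (t' : ZMod _), ?_⟩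
      rw [hg t ht, hg t' ht', h]; linarith
    · refine ⟨(t' : ZMod _), (t : ZMod _), ?_⟩
      rw [hg t ht, hg t' ht', h]; linarith

/-- The odd-case reduction preserves the folded diameter. -/
theorem odd_run_diameter (n : ℕ) [NeZero n] (θ : ZMod n → ℝ)
    (hcc : IsClosedCycle n θ)
    (hne : ∃ i j : ZMod n, θ i ≠ θ j)
    (m : ZMod n) (k : ℕ) [NeZero (n - k - 1)] (hk1 : 1 ≤ k) (hkodd : Odd k)
    (hrun₁ : θ m < θ (m - 1))
    (hrun₂ : ∀ j : ℕ, j < k → θ (m + (j : ZMod n)) = θ m)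
    (hrun₃ : θ m < θ (m + (k : ZMod n))) :
    foldedDiameter (n - k - 1) (oddShrink n θ m k) = foldedDiameter n θ := by
  exact ord_main n θ hcc m k hkodd hrun₁ hrun₂ hrun₃
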